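/- Let $p$ be a prime integer, $k$ a field of $\operatorname{char}(k) = p$, $n \geq 1$, and $F = k((\alpha_1))\dots((\alpha_n))$ the field of iterated Laurent series in $n$ indeterminates over $k$. Let $\beta_1,\dots,\beta_n \in k$ be elements whose images in $k/\wp(k)$ are $\mathbb{F}_p$-linearly independent, where $\wp(x) = x^p - x$. Then $D = [\beta_1,\alpha_1)_{p,F} \otimes_F \dots \otimes_F [\beta_n,\alpha_n)_{p,F}$ is a division algebra over $F$. -/

import Mathlib

open scoped TensorProduct

noncomputable def IterLaurentAux (k : Type) [Field k] : ℕ → (T : Type) × Field T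
  | 0 => ⟨k, inferInstance⟩
  | n + 1 =>
      letI := (IterLaurentAux k n).2
      ⟨LaurentSeries (IterLaurentAux k n).1, inferInstance⟩

/-- The field of iterated Laurent series `k((α₁))…((αₙ))` in `n` indeterminates over `k`. -/
noncomputable def IterLaurent (k : Type) [Field k] (n : ℕ) : Type :=
  (IterLaurentAux k n).1

noncomputable instance IterLaurent.instField (k : Type) [Field k] (n : ℕ) :
    Field (IterLaurent k n) :=
  (IterLaurentAux k n).2

/-- The indeterminates of `k((α₁))…((αₙ))`: `IterLaurent.var k n i` is `α_{i+1}`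
(so `i = 0` gives the innermost variable `α₁` and `i = n-1` the outermost one `αₙ`). -/
noncomputable def IterLaurent.var (k : Type) [Field k] : ∀ n, Fin n → IterLaurent k n
  | n + 1, i =>
      Fin.lastCases
        (show IterLaurent k (n + 1) from
          (HahnSeries.single (1 : ℤ) (1 : IterLaurent k n) : LaurentSeries (IterLaurent k n)))
        (fun j => show IterLaurent k (n + 1) from
          (HahnSeries.C (IterLaurent.var k n j) : LaurentSeries (IterLaurent k n)))
        i

/-- The canonical embedding of the base field `k` into `k((α₁))…((αₙ))`. -/
noncomputable def IterLaurent.ofBase (k : Type) [Field k] : ∀ n, k →+* IterLaurent k n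
  | 0 => RingHom.id k
  | n + 1 =>
      show k →+* IterLaurent k (n + 1) from
        ((HahnSeries.C : IterLaurent k n →+* LaurentSeries (IterLaurent k n)).comp
          (IterLaurent.ofBase k n) : k →+* LaurentSeries (IterLaurent k n))

noncomputable def SymGenX (F : Type) [Field F] : FreeAlgebra F (Fin 2) := FreeAlgebra.ι F 0
noncomputable def SymGenY (F : Type) [Field F] : FreeAlgebra F (Fin 2) := FreeAlgebra.ι F 1

/-- Relations of the symbol algebra `[a,b)_{p,F}` in characteristic `p`:
`x^p - x = a`, `y^p = b`, `y x = (x + 1) y` (i.e. `y x y⁻¹ = x + 1`). -/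
inductive ASSymbolRel (F : Type) [Field F] (p : ℕ) (a b : F) :
    FreeAlgebra F (Fin 2) → FreeAlgebra F (Fin 2) → Prop
  | x : ASSymbolRel F p a b (SymGenX F ^ p - SymGenX F) (algebraMap F _ a)
  | y : ASSymbolRel F p a b (SymGenY F ^ p) (algebraMap F _ b)
  | comm : ASSymbolRel F p a b (SymGenY F * SymGenX F) ((SymGenX F + 1) * SymGenY F)

/-- The degree-`p` symbol algebra `[a,b)_{p,F} = F⟨x,y : x^p - x = a, y^p = b, yxy⁻¹ = x+1⟩`
in characteristic `p`. -/
noncomputable def ASSymbol (F : Type) [Field F] (p : ℕ) (a b : F) : Type :=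
  RingQuot (ASSymbolRel F p a b)

noncomputable instance (F : Type) [Field F] (p : ℕ) (a b : F) : Ring (ASSymbol F p a b) :=
  inferInstanceAs (Ring (RingQuot (ASSymbolRel F p a b)))

noncomputable instance (F : Type) [Field F] (p : ℕ) (a b : F) : Algebra F (ASSymbol F p a b) :=
  inferInstanceAs (Algebra F (RingQuot (ASSymbolRel F p a b)))

/-- A (possibly noncommutative) ring is a division ring iff it is nontrivial and
every nonzero element is invertible. -/
def IsDivisionAlgebra (D : Type) [Ring D] : Prop :=
  Nontrivial D ∧ ∀ x : D, x ≠ 0 → IsUnit x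

/-- The images of `β₁, …, βₙ` in `k/℘(k)` are `𝔽_p`-linearly independent, where
`℘(z) = z^p - z` is the Artin–Schreier map. -/
def IndepModArtinSchreier (k : Type) [Field k] (p : ℕ) {n : ℕ} (β : Fin n → k) : Prop :=
  ∀ c : Fin n → ℕ, (∀ i, c i < p) →
    (∃ z : k, ∑ i, (c i : k) * β i = z ^ p - z) → ∀ i, c i = 0

/-- Elements of an Artin–Schreier-independent family have roots of `X ^ p - X - β i` that can be
translated independently of each other by automorphisms of a Galois extension. -/
theorem exists_algEquiv_translate {k : Type} [Field k] {p n : ℕ} [Fact p.Prime] [CharP k p]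
    {K : Type*} [Field K] [Algebra k K] [IsGalois k K] {β : Fin n → k}
    (hβ : IndepModArtinSchreier k p β) {x : Fin n → K}
    (hx : ∀ i, x i ^ p - x i = algebraMap k K (β i)) (w : Fin n → ZMod p) :
    ∃ g : K ≃ₐ[k] K, ∀ j, g (x j) = x j + (w j).cast := by
  have : CharP K p := charP_of_injective_algebraMap (algebraMap k K).injective p
  let : Algebra (ZMod p) K := ZMod.algebra K p
  have hcast (c : ZMod p) : (c.cast : K) = algebraMap (ZMod p) K c := rfl
  simp only [hcast]
  have hfix (g : K ≃ₐ[k] K) (c : ZMod p) :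
      g (algebraMap (ZMod p) K c) = algebraMap (ZMod p) K c :=
    RingHom.congr_fun (Subsingleton.elim ((g : K →+* K).comp (algebraMap (ZMod p) K)) _) _
  let W : AddSubgroup (Fin n → ZMod p) :=
    { carrier := {w | ∃ g : K ≃ₐ[k] K, ∀ j, g (x j) = x j + algebraMap (ZMod p) K (w j)}
      zero_mem' := ⟨1, by simp⟩
      add_mem' := by
        rintro a b ⟨g, hg⟩ ⟨h, hh⟩
        refine ⟨g * h, fun j => ?_⟩
        simp [hh, hg, hfix, add_assoc]
      neg_mem' := by
        rintro a ⟨g, hg⟩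
        refine ⟨g⁻¹, fun j => ?_⟩
        apply g.injective
        rw [← AlgEquiv.mul_apply, mul_inv_cancel]
        simp [hg, hfix] }
  suffices h : AddSubgroup.toZModSubmodule p W = ⊤ from
    (h ▸ Submodule.mem_top : w ∈ AddSubgroup.toZModSubmodule p W)
  by_contra hW
  obtain ⟨φ, hφ, hle⟩ := Submodule.exists_le_ker_of_lt_top _ (lt_top_iff_ne_top.mpr hW)
  have hφ_apply (v : Fin n → ZMod p) : φ v = ∑ j, φ (Pi.single j 1) * v j := by
    conv_lhs => rw [← Finset.univ_sum_single v]
    rw [map_sum]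
    refine Finset.sum_congr rfl fun j _ => ?_
    rw [mul_comm, ← smul_eq_mul, ← map_smul, ← Pi.single_smul, smul_eq_mul, mul_one]
  have htrans (g : K ≃ₐ[k] K) (j : Fin n) :
      ∃ c : ZMod p, g (x j) - x j = algebraMap (ZMod p) K c := by
    have h1 : (g (x j) - x j) ^ p = g (x j) - x j := by
      have h2 := congrArg g (hx j)
      rw [map_sub, map_pow, AlgEquiv.commutes] at h2
      rw [sub_pow_char]
      linear_combination h2 - hx j
    have h2 := (Subfield.mem_bot_iff_pow_eq_self K p).mpr h1
    obtain ⟨c, hc⟩ := bot_le (a := (algebraMap (ZMod p) K).fieldRange) h2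
    exact ⟨c, hc.symm⟩
  obtain ⟨z, hz⟩ := IntermediateField.mem_bot.mp ((InfiniteGalois.mem_bot_iff_fixed
    (k := k) (∑ j, algebraMap (ZMod p) K (φ (Pi.single j 1)) * x j)).mpr fun g => by
      choose c hc using htrans g
      have hcW : c ∈ AddSubgroup.toZModSubmodule p W :=
        ⟨g, fun j => by rw [← hc]; ring⟩
      have h0 := hle hcW
      rw [LinearMap.mem_ker, hφ_apply] at h0
      have h1 := congrArg (algebraMap (ZMod p) K) h0
      simp only [map_sum, map_mul, map_zero, ← hc, mul_sub, Finset.sum_sub_distrib] at h1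
      rw [map_sum, ← sub_eq_zero, ← h1]
      simp only [map_mul, hfix])
  apply hφ
  ext j
  have hzero := hβ (fun j => (φ (Pi.single j 1)).val) (fun j => ZMod.val_lt _) ⟨z, by
    apply (algebraMap k K).injective
    have hc (c : ZMod p) : algebraMap (ZMod p) K c ^ p = algebraMap (ZMod p) K c := by
      rw [← map_pow, ZMod.pow_card]
    have hv (c : ZMod p) : (c.val : K) = algebraMap (ZMod p) K c := by
      rw [← map_natCast (algebraMap (ZMod p) K), ZMod.natCast_zmod_val]
    simp only [map_sum, map_mul, map_natCast, hv, map_sub, map_pow, hz, ← hx, sum_pow_char,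
      mul_pow, hc, mul_sub, Finset.sum_sub_distrib]⟩ j
  simpa using hzero

/-- Monomials of degree `< p` in each variable are linearly independent at a point all of whose
`𝔽_p`-translates are conjugate. -/
theorem linearIndependent_monomials_of_translate {k K : Type*} [Field k] [Field K] [Algebra k K]
    {p n : ℕ} [Fact p.Prime] [CharP K p] {x : Fin n → K}
    (hx : ∀ w : Fin n → ZMod p, ∃ g : K ≃ₐ[k] K, ∀ j, g (x j) = x j + (w j).cast) :
    LinearIndependent k fun a : Fin n → Fin p => ∏ i, x i ^ (a i : ℕ) := by
  classical
  let : Algebra (ZMod p) K := ZMod.algebra K p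
  rw [Fintype.linearIndependent_iff]
  intro c hc a₀
  let e (a : Fin n → Fin p) : Fin n →₀ ℕ := Finsupp.equivFunOnFinite.symm fun i => (a i : ℕ)
  have he : Function.Injective e := fun a b h => by
    ext i
    exact congrArg (fun f : Fin n →₀ ℕ => f i) h
  let P : MvPolynomial (Fin n) K :=
    ∑ a, MvPolynomial.monomial (e a) (algebraMap k K (c a))
  let S (i : Fin n) : Finset K := Finset.univ.image fun w : ZMod p => x i + algebraMap (ZMod p) K w
  have hS (i : Fin n) : (S i).card = p := by
    rw [Finset.card_image_of_injective _ fun a b h =>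
      (algebraMap (ZMod p) K).injective (add_left_cancel h), Finset.card_univ, ZMod.card]
  have hP : P = 0 := by
    refine MvPolynomial.eq_zero_of_eval_zero_at_prod_finset P S (fun i => ?_) fun y hy => ?_
    · rw [hS, MvPolynomial.degreeOf_lt_iff (Fact.out : p.Prime).pos]
      intro m hm
      obtain ⟨a, -, ha⟩ := Finset.mem_biUnion.mp (MvPolynomial.support_sum hm)
      rw [Finset.mem_singleton.mp (MvPolynomial.support_monomial_subset ha)]
      exact (a i).2
    · choose w _ hw using fun i => Finset.mem_image.mp (hy i)
      obtain ⟨g, hg⟩ := hx w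
      have hy' : y = fun i => g (x i) := funext fun i => (hw i).symm.trans (hg i).symm
      have h0 := congrArg g hc
      simpa [P, hy', MvPolynomial.eval_monomial, Finsupp.prod_fintype, e, Algebra.smul_def]
        using h0
  have h0 := congrArg (MvPolynomial.coeff (e a₀)) hP
  simpa [P, MvPolynomial.coeff_sum, MvPolynomial.coeff_monomial, he.eq_iff] using h0

/-- An Artin–Schreier-independent family `β` is split by an extension that has the monomials in
the roots `x i` as linearly independent elements and admits commuting automorphisms of order `p`
translating the roots one at a time. -/
theorem exists_artinSchreier_extension {k : Type} [Field k] {p n : ℕ} [Fact p.Prime] [CharP k p]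
    {β : Fin n → k} (hβ : IndepModArtinSchreier k p β) :
    ∃ (l : Type) (_ : Field l) (_ : Algebra k l) (x : Fin n → l) (s : Fin n → l →ₐ[k] l),
      (∀ i, x i ^ p - x i = algebraMap k l (β i)) ∧
      (∀ i j, s i (x j) = x j + if j = i then 1 else 0) ∧
      (∀ i j, (s i).comp (s j) = (s j).comp (s i)) ∧ (∀ i, s i ^ p = 1) ∧
      LinearIndependent k fun a : Fin n → Fin p => ∏ i, x i ^ (a i : ℕ) := by
  let K := SeparableClosure k
  have : CharP K p := charP_of_injective_algebraMap (algebraMap k K).injective p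
  have hroot (i : Fin n) : ∃ y : K, y ^ p - y = algebraMap k K (β i) := by
    obtain ⟨y, hy⟩ := IsSepClosed.exists_root_C_mul_X_pow_add_C_mul_X_add_C' p p (1 : K) (-1)
      (-algebraMap k K (β i)) dvd_rfl (Fact.out : p.Prime).two_le (by simp)
    exact ⟨y, by linear_combination hy⟩
  choose y hy using hroot
  have hg := exists_algEquiv_translate hβ hy
  let l := IntermediateField.adjoin k (Set.range y)
  let x (i : Fin n) : l := ⟨y i, IntermediateField.subset_adjoin k _ ⟨i, rfl⟩⟩
  choose g hgx using fun i : Fin n => hg (Pi.single i 1)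
  have hgx' (i j : Fin n) : g i (y j) = y j + if j = i then 1 else 0 := by
    rw [hgx, Pi.single_apply]
    split_ifs <;> simp
  have hmap (i : Fin n) (z : l) : g i z ∈ l := by
    have hle : l ≤ l.comap (g i : K →ₐ[k] K) := by
      refine IntermediateField.adjoin_le_iff.mpr ?_
      rintro _ ⟨j, rfl⟩
      change g i (y j) ∈ l
      rw [hgx']
      exact add_mem (x j).2 (by split_ifs <;> simp)
    exact hle z.2
  let s (i : Fin n) : l →ₐ[k] l :=
    ((g i : K →ₐ[k] K).comp l.val).codRestrict l.toSubalgebra (hmap i)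
  have hs (i j : Fin n) : s i (x j) = x j + if j = i then 1 else 0 := by
    apply Subtype.ext
    change g i (y j) = _
    rw [hgx']
    split_ifs <;> simp [x]
  have hext {f h : l →ₐ[k] l} (hfh : ∀ j, f (x j) = h (x j)) : f = h := by
    refine IntermediateField.algHom_ext_of_eq_adjoin (K := l) (s := Set.range y) k rfl ?_
    rintro _ ⟨j, rfl⟩
    exact hfh j
  refine ⟨l, inferInstance, inferInstance, x, s, fun i => Subtype.ext (hy i), hs, fun i j => ?_,
    fun i => ?_, ?_⟩
  · refine hext fun m => ?_
    simp only [AlgHom.comp_apply, hs, map_add, apply_ite (s _), map_one, map_zero]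
    ring
  · refine hext fun m => ?_
    have hpow (r : ℕ) : (s i ^ r) (x m) = x m + r * if m = i then 1 else 0 := by
      induction r with
      | zero => simp
      | succ r ih =>
        rw [pow_succ, AlgHom.mul_apply, hs, map_add, ih, apply_ite (s i ^ r)]
        split_ifs <;> simp [add_assoc]
    rw [hpow]
    have : CharP l p := charP_of_injective_algebraMap (algebraMap k l).injective p
    simp
  · have hlin := linearIndependent_monomials_of_translate (k := k) hg
    refine LinearIndependent.of_comp l.val.toLinearMap ?_
    convert hlin using 1
    ext a
    simp [x]

/-- The ring homomorphism `∑ aᵢ Xⁱ ↦ ∑ f(aᵢ) Xᵐⁱ` of Laurent series. -/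
noncomputable def LaurentSeries.mapExpand {A B : Type*} [Field A] [Field B] (f : A →+* B) (m : ℕ)
    [NeZero m] : LaurentSeries A →+* LaurentSeries B :=
  (HahnSeries.embDomainRingHom (AddMonoidHom.mulLeft (m : ℤ))
    (mul_right_injective₀ (NeZero.ne _)) fun _ _ =>
      mul_le_mul_iff_right₀ (by exact_mod_cast NeZero.pos m)).comp
    { toFun := fun z => z.map f
      map_one' := HahnSeries.map_one f.toMonoidWithZeroHom
      map_mul' := fun _ _ => HahnSeries.map_mul (f : A →ₙ+* B)
      map_zero' := HahnSeries.map_zero (f : ZeroHom A B)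
      map_add' := fun _ _ => by ext; simp }

namespace LaurentSeries

variable {A B C : Type*} [Field A] [Field B] [Field C] (f : A →+* B) (m : ℕ) [NeZero m]

theorem coeff_mapExpand_mul (z : LaurentSeries A) (i : ℤ) :
    (mapExpand f m z).coeff (m * i) = f (z.coeff i) :=
  HahnSeries.embDomain_mk_coeff (f := fun i : ℤ => (m : ℤ) * i) _ _

theorem coeff_mapExpand_of_not_dvd (z : LaurentSeries A) {i : ℤ} (hi : ¬(m : ℤ) ∣ i) :
    (mapExpand f m z).coeff i = 0 := by
  refine HahnSeries.embDomain_of_notMem_range ?_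
  rintro ⟨j, rfl⟩
  exact hi ⟨j, rfl⟩

theorem coeff_mapExpand_one (z : LaurentSeries A) (i : ℤ) :
    (mapExpand f 1 z).coeff i = f (z.coeff i) := by
  simpa using coeff_mapExpand_mul f 1 z i

theorem mapExpand_C (a : A) : mapExpand f m (HahnSeries.C a) = HahnSeries.C (f a) := by
  change HahnSeries.embDomainRingHom _ _ _ ((HahnSeries.C a).map f) = _
  rw [HahnSeries.map_C]
  exact HahnSeries.embDomainRingHom_C

theorem mapExpand_single_one :
    mapExpand f m (HahnSeries.single 1 1) = HahnSeries.single (1 : ℤ) (1 : B) ^ m := by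
  change HahnSeries.embDomain _ ((HahnSeries.single 1 1).map (f : ZeroHom A B)) = _
  rw [HahnSeries.map_single, HahnSeries.embDomain_single, HahnSeries.single_pow]
  simp

theorem mapExpand_one_mapExpand (g : B →+* C) (z : LaurentSeries A) :
    mapExpand g 1 (mapExpand f m z) = mapExpand (g.comp f) m z := by
  ext i
  rw [coeff_mapExpand_one]
  by_cases hi : (m : ℤ) ∣ i
  · obtain ⟨j, rfl⟩ := hi
    rw [coeff_mapExpand_mul, coeff_mapExpand_mul, RingHom.comp_apply]
  · rw [coeff_mapExpand_of_not_dvd _ _ _ hi, coeff_mapExpand_of_not_dvd _ _ _ hi, map_zero]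

theorem mapExpand_id_one (z : LaurentSeries A) : mapExpand (RingHom.id A) 1 z = z := by
  ext i
  rw [coeff_mapExpand_one, RingHom.id_apply]

theorem order_mapExpand_one (z : LaurentSeries A) : (mapExpand f 1 z).order = z.order := by
  rcases eq_or_ne z 0 with rfl | hz
  · simp
  have hz' : mapExpand f 1 z ≠ 0 := (map_ne_zero _).mpr hz
  refine le_antisymm (HahnSeries.order_le_of_coeff_ne_zero ?_)
    (HahnSeries.order_le_of_coeff_ne_zero ?_)
  · rw [coeff_mapExpand_one, map_ne_zero, Ne, HahnSeries.coeff_order_eq_zero]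
    exact hz
  · rw [← map_ne_zero f, ← coeff_mapExpand_one, Ne, HahnSeries.coeff_order_eq_zero]
    exact hz'

theorem leadingCoeff_mapExpand_one (z : LaurentSeries A) :
    (mapExpand f 1 z).leadingCoeff = f z.leadingCoeff := by
  rw [HahnSeries.leadingCoeff_eq, order_mapExpand_one, coeff_mapExpand_one,
    HahnSeries.leadingCoeff_eq]

end LaurentSeries

namespace IterLaurent

/-- `k((α₁))…((αₙ₊₁))` as the field of Laurent series in `αₙ₊₁` over `k((α₁))…((αₙ))`. -/
noncomputable def toLaurent (k : Type) [Field k] (n : ℕ) :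
    IterLaurent k (n + 1) ≃+* LaurentSeries (IterLaurent k n) :=
  RingEquiv.refl (LaurentSeries (IterLaurent k n))

/-- The ring homomorphism `k((α₁))…((αₙ)) → l((α₁))…((αₙ))` given by `f` on coefficients and by
`αᵢ ↦ αᵢ ^ m`. -/
noncomputable def mapExpand {k l : Type} [Field k] [Field l] (f : k →+* l) (m : ℕ) [NeZero m] :
    ∀ n, IterLaurent k n →+* IterLaurent l n
  | 0 => f
  | n + 1 => ((toLaurent l n).symm : _ →+* _).comp
      ((LaurentSeries.mapExpand (mapExpand f m n) m).comp (toLaurent k n : _ →+* _))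

/-- The exponent vector of the lowest monomial, for the lexicographic order in which outer
variables are more significant. -/
noncomputable def exponent {k : Type} [Field k] : ∀ n, IterLaurent k n → Fin n → ℤ
  | 0, _ => 0
  | n + 1, z => Fin.snoc (α := fun _ => ℤ) (exponent n (toLaurent k n z).leadingCoeff)
      (toLaurent k n z).order

variable {k l : Type} [Field k] [Field l]

theorem toLaurent_ofBase (n : ℕ) (b : k) :
    toLaurent k n (ofBase k (n + 1) b) = HahnSeries.C (ofBase k n b) := rfl

theorem toLaurent_var_last (n : ℕ) :
    toLaurent k n (var k (n + 1) (Fin.last n)) = HahnSeries.single 1 1 := by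
  exact Fin.lastCases_last (motive := fun _ => IterLaurent k (n + 1))

theorem toLaurent_var_castSucc (n : ℕ) (j : Fin n) :
    toLaurent k n (var k (n + 1) j.castSucc) = HahnSeries.C (var k n j) := by
  exact Fin.lastCases_castSucc (motive := fun _ => IterLaurent k (n + 1)) j

theorem toLaurent_mapExpand (f : k →+* l) (m : ℕ) [NeZero m] (n : ℕ) (z : IterLaurent k (n + 1)) :
    toLaurent l n (mapExpand f m (n + 1) z) =
      LaurentSeries.mapExpand (mapExpand f m n) m (toLaurent k n z) := rfl

theorem exponent_succ_castSucc (n : ℕ) (z : IterLaurent k (n + 1)) (j : Fin n) :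
    exponent (n + 1) z j.castSucc = exponent n (toLaurent k n z).leadingCoeff j := by
  simp [exponent]

theorem exponent_succ_last (n : ℕ) (z : IterLaurent k (n + 1)) :
    exponent (n + 1) z (Fin.last n) = (toLaurent k n z).order := by
  simp [exponent]

theorem mapExpand_ofBase (f : k →+* l) (m : ℕ) [NeZero m] (n : ℕ) (b : k) :
    mapExpand f m n (ofBase k n b) = ofBase l n (f b) := by
  induction n with
  | zero => rfl
  | succ n ih =>
    apply (toLaurent l n).injective
    rw [toLaurent_mapExpand, toLaurent_ofBase, toLaurent_ofBase, LaurentSeries.mapExpand_C, ih]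

theorem mapExpand_var (f : k →+* l) (m : ℕ) [NeZero m] (n : ℕ) (i : Fin n) :
    mapExpand f m n (var k n i) = var l n i ^ m := by
  induction n with
  | zero => exact i.elim0
  | succ n ih =>
    apply (toLaurent l n).injective
    rw [toLaurent_mapExpand, map_pow]
    refine Fin.lastCases ?_ (fun j => ?_) i
    · rw [toLaurent_var_last, toLaurent_var_last, LaurentSeries.mapExpand_single_one]
    · rw [toLaurent_var_castSucc, toLaurent_var_castSucc, LaurentSeries.mapExpand_C, ih, map_pow]

theorem mapExpand_one_mapExpand {l' : Type} [Field l'] (g : l →+* l') (f : k →+* l) (m : ℕ)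
    [NeZero m] (n : ℕ) (z : IterLaurent k n) :
    mapExpand g 1 n (mapExpand f m n z) = mapExpand (g.comp f) m n z := by
  induction n with
  | zero => rfl
  | succ n ih =>
    apply (toLaurent l' n).injective
    rw [toLaurent_mapExpand, toLaurent_mapExpand, toLaurent_mapExpand,
      LaurentSeries.mapExpand_one_mapExpand]
    congr 2
    exact RingHom.ext ih

theorem mapExpand_id_one (n : ℕ) : mapExpand (RingHom.id k) 1 n = RingHom.id _ := by
  induction n with
  | zero => rfl
  | succ n ih =>
    ext z
    apply (toLaurent k n).injective
    rw [toLaurent_mapExpand, ih, LaurentSeries.mapExpand_id_one, RingHom.id_apply]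

theorem exponent_mapExpand_one (f : k →+* l) (n : ℕ) (z : IterLaurent k n) :
    exponent n (mapExpand f 1 n z) = exponent n z := by
  induction n with
  | zero => rfl
  | succ n ih =>
    simp only [exponent, toLaurent_mapExpand, LaurentSeries.leadingCoeff_mapExpand_one,
      LaurentSeries.order_mapExpand_one, ih]

theorem exponent_mul (n : ℕ) {z w : IterLaurent k n} (hz : z ≠ 0) (hw : w ≠ 0) :
    exponent n (z * w) = exponent n z + exponent n w := by
  induction n with
  | zero => rfl
  | succ n ih =>
    have hz' : toLaurent k n z ≠ 0 := (map_ne_zero_iff _ (toLaurent k n).injective).mpr hz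
    have hw' : toLaurent k n w ≠ 0 := (map_ne_zero_iff _ (toLaurent k n).injective).mpr hw
    ext i
    refine Fin.lastCases ?_ (fun j => ?_) i
    · rw [Pi.add_apply, exponent_succ_last, exponent_succ_last, exponent_succ_last, map_mul,
        HahnSeries.order_mul hz' hw']
    · rw [Pi.add_apply, exponent_succ_castSucc, exponent_succ_castSucc, exponent_succ_castSucc,
        map_mul, HahnSeries.leadingCoeff_mul, ih (HahnSeries.leadingCoeff_ne_zero.mpr hz')
          (HahnSeries.leadingCoeff_ne_zero.mpr hw'), Pi.add_apply]

theorem exponent_one (n : ℕ) : exponent n (1 : IterLaurent k n) = 0 := by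
  simpa using exponent_mul n (one_ne_zero (α := IterLaurent k n)) one_ne_zero

theorem var_ne_zero (n : ℕ) (i : Fin n) : var k n i ≠ 0 := by
  induction n with
  | zero => exact i.elim0
  | succ n ih =>
    rw [← map_ne_zero_iff _ (toLaurent k n).injective]
    refine Fin.lastCases ?_ (fun j => ?_) i
    · simp [toLaurent_var_last]
    · rw [toLaurent_var_castSucc, map_ne_zero]
      exact ih j

theorem exponent_var (n : ℕ) (i : Fin n) : exponent n (var k n i) = Pi.single i 1 := by
  induction n with
  | zero => exact i.elim0
  | succ n ih =>
    refine Fin.lastCases ?_ (fun j => ?_) i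
    · ext i
      refine Fin.lastCases ?_ (fun j' => ?_) i
      · simp [exponent_succ_last, toLaurent_var_last]
      · rw [exponent_succ_castSucc, toLaurent_var_last, HahnSeries.leadingCoeff_of_single,
          exponent_one, Pi.single_eq_of_ne (Fin.castSucc_lt_last j').ne, Pi.zero_apply]
    · ext i
      refine Fin.lastCases ?_ (fun j' => ?_) i
      · rw [exponent_succ_last, toLaurent_var_castSucc, HahnSeries.order_C,
          Pi.single_eq_of_ne (Fin.castSucc_lt_last j).ne']
      · rw [exponent_succ_castSucc, toLaurent_var_castSucc, HahnSeries.C_apply,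
          HahnSeries.leadingCoeff_of_single, ih, Pi.single_apply, Pi.single_apply]
        simp

theorem exponent_prod_var_pow (n : ℕ) (b : Fin n → ℕ) :
    exponent n (∏ i, var k n i ^ b i) = fun i => (b i : ℤ) := by
  have hpow (i : Fin n) (m : ℕ) : exponent n (var k n i ^ m) = m • Pi.single i 1 := by
    induction m with
    | zero => simpa using exponent_one n
    | succ m ih =>
      rw [pow_succ, exponent_mul n (pow_ne_zero _ (var_ne_zero n i)) (var_ne_zero n i), ih,
        exponent_var, succ_nsmul]
  have h (S : Finset (Fin n)) : exponent n (∏ i ∈ S, var k n i ^ b i) =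
      ∑ i ∈ S, b i • (Pi.single i 1 : Fin n → ℤ) := by
    induction S using Finset.induction_on with
    | empty => simpa using exponent_one n
    | insert i S hi ih =>
      rw [Finset.prod_insert hi, Finset.sum_insert hi, ← ih, ← hpow,
        exponent_mul n (pow_ne_zero _ (var_ne_zero n i))
          (Finset.prod_ne_zero_iff.mpr fun j _ => pow_ne_zero _ (var_ne_zero n j))]
  rw [h]
  ext i
  simp [Finset.sum_apply, Pi.single_apply]

/-- Elements with pairwise distinct lowest monomials have a nonzero sum. -/
theorem sum_ne_zero_of_exponent_injOn (n : ℕ) {ι : Type*} {s : Finset ι} (hs : s.Nonempty)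
    {f : ι → IterLaurent k n} (hf : ∀ i ∈ s, f i ≠ 0)
    (hinj : Set.InjOn (fun i => exponent n (f i)) s) : ∑ i ∈ s, f i ≠ 0 := by
  classical
  induction n generalizing s with
  | zero =>
    obtain ⟨i, hi⟩ := hs
    rw [Finset.sum_eq_single_of_mem i hi fun j hj hji => (hji (hinj hj hi rfl)).elim]
    exact hf i hi
  | succ n ih =>
    obtain ⟨i₀, hi₀, hmin⟩ := s.exists_min_image (fun i => (toLaurent k n (f i)).order) hs
    set d := (toLaurent k n (f i₀)).order with hd
    have hcoeff : (toLaurent k n (∑ i ∈ s, f i)).coeff d =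
        ∑ i ∈ s with (toLaurent k n (f i)).order = d, (toLaurent k n (f i)).leadingCoeff := by
      rw [map_sum, HahnSeries.coeff_sum, Finset.sum_filter]
      refine Finset.sum_congr rfl fun i hi => ?_
      split_ifs with h
      · rw [HahnSeries.leadingCoeff_eq, h]
      · exact HahnSeries.coeff_eq_zero_of_lt_order (lt_of_le_of_ne (hmin i hi) (Ne.symm h))
    have hne := ih (s := {i ∈ s | (toLaurent k n (f i)).order = d})
      (f := fun i => (toLaurent k n (f i)).leadingCoeff)
      ⟨i₀, Finset.mem_filter.mpr ⟨hi₀, rfl⟩⟩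
      (fun i hi => HahnSeries.leadingCoeff_ne_zero.mpr <|
        (map_ne_zero_iff _ (toLaurent k n).injective).mpr (hf i (Finset.mem_filter.mp hi).1))
      (fun i hi j hj hij => by
        obtain ⟨hi, hid⟩ := Finset.mem_filter.mp hi
        obtain ⟨hj, hjd⟩ := Finset.mem_filter.mp hj
        refine hinj hi hj ?_
        simp only [exponent, hid, hjd]
        exact congrArg (Fin.snoc (α := fun _ => ℤ) · d) hij)
    rw [← hcoeff] at hne
    intro h0
    rw [h0] at hne
    simp at hne

/-- A nontrivial combination of linearly independent elements of `l`, with coefficients from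
`k((α₁ᵐ))…((αₙᵐ))`, is nonzero and its lowest monomial is an `m`-th power. -/
theorem sum_mapExpand_mul_ofBase [Algebra k l] (m : ℕ) [NeZero m] (n : ℕ) {ι : Type*} [Fintype ι]
    {e : ι → l} (he : LinearIndependent k e) {c : ι → IterLaurent k n} (hc : c ≠ 0) :
    (∑ a, mapExpand (algebraMap k l) m n (c a) * ofBase l n (e a)) ≠ 0 ∧
    ∀ i, (m : ℤ) ∣
      exponent n (∑ a, mapExpand (algebraMap k l) m n (c a) * ofBase l n (e a)) i := by
  induction n with
  | zero =>
    refine ⟨fun h0 => hc (funext fun a => ?_), fun i => i.elim0⟩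
    refine Fintype.linearIndependent_iff.mp he c ?_ a
    exact (Finset.sum_congr rfl fun b _ => Algebra.smul_def (R := k) (c b) (e b)).trans h0
  | succ n ih =>
    set z := ∑ a, mapExpand (algebraMap k l) m (n + 1) (c a) * ofBase l (n + 1) (e a) with hz
    have hcoeff (d : ℤ) : (toLaurent l n z).coeff (m * d) =
        ∑ a, mapExpand (algebraMap k l) m n ((toLaurent k n (c a)).coeff d) * ofBase l n (e a) := by
      rw [hz, map_sum, HahnSeries.coeff_sum]
      refine Finset.sum_congr rfl fun a _ => ?_
      rw [map_mul, toLaurent_ofBase, toLaurent_mapExpand, mul_comm, HahnSeries.C_mul_eq_smul,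
        HahnSeries.coeff_smul, smul_eq_mul,
        LaurentSeries.coeff_mapExpand_mul, mul_comm]
    have hcoeff' {d : ℤ} (hd : ¬(m : ℤ) ∣ d) : (toLaurent l n z).coeff d = 0 := by
      rw [hz, map_sum, HahnSeries.coeff_sum]
      refine Finset.sum_eq_zero fun a _ => ?_
      rw [map_mul, toLaurent_ofBase, toLaurent_mapExpand, mul_comm, HahnSeries.C_mul_eq_smul,
        HahnSeries.coeff_smul, smul_eq_mul,
        LaurentSeries.coeff_mapExpand_of_not_dvd _ _ _ hd, mul_zero]
    obtain ⟨a, ha⟩ := Function.ne_iff.mp hc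
    have hz0 : toLaurent l n z ≠ 0 := by
      have ha' : toLaurent k n (c a) ≠ 0 := (map_ne_zero_iff _ (toLaurent k n).injective).mpr ha
      have h1 := (ih (c := fun b => (toLaurent k n (c b)).coeff (toLaurent k n (c a)).order)
        (Function.ne_iff.mpr ⟨a, HahnSeries.coeff_order_eq_zero.not.mpr ha'⟩)).1
      rw [← hcoeff] at h1
      intro h0
      simp [h0] at h1
    refine ⟨(map_ne_zero_iff _ (toLaurent l n).injective).mp hz0, fun i => ?_⟩
    have hdvd : (m : ℤ) ∣ (toLaurent l n z).order := by
      by_contra h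
      exact hz0 (HahnSeries.coeff_order_eq_zero.mp (hcoeff' h))
    refine Fin.lastCases ?_ (fun j => ?_) i
    · rwa [exponent_succ_last]
    · obtain ⟨d, hd⟩ := hdvd
      rw [exponent_succ_castSucc, HahnSeries.leadingCoeff_eq, hd, hcoeff]
      refine (ih fun h0 => hz0 ?_).2 j
      rw [← HahnSeries.coeff_order_eq_zero, hd, hcoeff]
      refine Finset.sum_eq_zero fun b _ => ?_
      rw [show (toLaurent k n (c b)).coeff d = 0 from congrFun h0 b, map_zero, zero_mul]

end IterLaurent

namespace ASSymbol

variable {F : Type} [Field F] {p : ℕ} {a b : F}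

/-- The generator `x` of the symbol algebra. -/
noncomputable def x (F : Type) [Field F] (p : ℕ) (a b : F) : ASSymbol F p a b :=
  RingQuot.mkAlgHom F (ASSymbolRel F p a b) (SymGenX F)

/-- The generator `y` of the symbol algebra. -/
noncomputable def y (F : Type) [Field F] (p : ℕ) (a b : F) : ASSymbol F p a b :=
  RingQuot.mkAlgHom F (ASSymbolRel F p a b) (SymGenY F)

theorem x_pow : x F p a b ^ p = x F p a b + algebraMap F _ a := by
  have h := RingQuot.mkAlgHom_rel F (ASSymbolRel.x (p := p) (a := a) (b := b))
  rw [map_sub, map_pow, AlgHom.commutes] at h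
  exact sub_eq_iff_eq_add'.mp h

theorem y_pow : y F p a b ^ p = algebraMap F _ b := by
  have h := RingQuot.mkAlgHom_rel F (ASSymbolRel.y (p := p) (a := a) (b := b))
  rw [map_pow, AlgHom.commutes] at h
  exact h

theorem y_mul_x : y F p a b * x F p a b = (x F p a b + 1) * y F p a b := by
  have h := RingQuot.mkAlgHom_rel F (ASSymbolRel.comm (p := p) (a := a) (b := b))
  rw [map_mul, map_mul, map_add, map_one] at h
  exact h

/-- The universal property of the symbol algebra. -/
noncomputable def lift {A : Type*} [Ring A] [Algebra F A] (u v : A)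
    (hu : u ^ p - u = algebraMap F A a) (hv : v ^ p = algebraMap F A b)
    (huv : v * u = (u + 1) * v) : ASSymbol F p a b →ₐ[F] A :=
  RingQuot.liftAlgHom F ⟨FreeAlgebra.lift F ![u, v], fun _ _ h => by
    cases h <;> simp [SymGenX, SymGenY, hu, hv, huv]⟩

theorem lift_x {A : Type*} [Ring A] [Algebra F A] {u v : A} (hu : u ^ p - u = algebraMap F A a)
    (hv : v ^ p = algebraMap F A b) (huv : v * u = (u + 1) * v) :
    lift u v hu hv huv (x F p a b) = u :=
  (RingQuot.liftAlgHom_mkAlgHom_apply F _ _ _).trans (by simp [SymGenX])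

theorem lift_y {A : Type*} [Ring A] [Algebra F A] {u v : A} (hu : u ^ p - u = algebraMap F A a)
    (hv : v ^ p = algebraMap F A b) (huv : v * u = (u + 1) * v) :
    lift u v hu hv huv (y F p a b) = v :=
  (RingQuot.liftAlgHom_mkAlgHom_apply F _ _ _).trans (by simp [SymGenY])

theorem adjoin_eq_top : Algebra.adjoin F {x F p a b, y F p a b} = ⊤ := by
  have h := (RingQuot.mkAlgHom F (ASSymbolRel F p a b)).map_adjoin
    (Set.range (FreeAlgebra.ι F : Fin 2 → FreeAlgebra F (Fin 2)))
  rw [FreeAlgebra.adjoin_range_ι, Algebra.map_top,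
    (AlgHom.range_eq_top _).mpr (RingQuot.mkAlgHom_surjective F _), ← Set.range_comp] at h
  refine Eq.trans (congrArg (Algebra.adjoin F) ?_) h.symm
  refine Set.Subset.antisymm ?_ ?_
  · rintro _ (rfl | rfl)
    exacts [⟨0, rfl⟩, ⟨1, rfl⟩]
  · rintro _ ⟨i, rfl⟩
    fin_cases i
    exacts [Or.inl rfl, Or.inr rfl]

theorem commute_of_commute_generators {A : Type*} [Ring A] [Algebra F A]
    (f : ASSymbol F p a b →ₐ[F] A) {c : A} (hx : Commute (f (x F p a b)) c)
    (hy : Commute (f (y F p a b)) c) (d : ASSymbol F p a b) : Commute (f d) c := by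
  have hd : d ∈ Algebra.adjoin F {x F p a b, y F p a b} := by
    rw [adjoin_eq_top]; exact Algebra.mem_top
  induction hd using Algebra.adjoin_induction with
  | mem d hd => rcases hd with rfl | rfl <;> assumption
  | algebraMap r => rw [AlgHom.commutes]; exact Algebra.commutes r c
  | add d d' _ _ h h' => rw [map_add]; exact h.add_left h'
  | mul d d' _ _ h h' => rw [map_mul]; exact h.mul_left h'

theorem span_monomials [Fact p.Prime] :
    Submodule.span F (Set.range fun ij : Fin p × Fin p =>
      x F p a b ^ (ij.1 : ℕ) * y F p a b ^ (ij.2 : ℕ)) = ⊤ := by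
  set M := Submodule.span F (Set.range fun ij : Fin p × Fin p =>
    x F p a b ^ (ij.1 : ℕ) * y F p a b ^ (ij.2 : ℕ)) with hM
  have hp := (Fact.out : p.Prime)
  have hxy (i : ℕ) {j : ℕ} (hj : j < p) : x F p a b ^ i * y F p a b ^ j ∈ M := by
    induction i using Nat.strong_induction_on with
    | _ i ih =>
      rcases lt_or_ge i p with hi | hi
      · exact Submodule.subset_span ⟨(⟨i, hi⟩, ⟨j, hj⟩), rfl⟩
      · obtain ⟨r, rfl⟩ := Nat.exists_eq_add_of_le hi
        have h1 := ih (r + 1) (by have := hp.two_le; lia)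
        have h2 := M.smul_mem a (ih r (by have := hp.two_le; lia))
        have h3 : x F p a b ^ (p + r) * y F p a b ^ j =
            x F p a b ^ (r + 1) * y F p a b ^ j + a • (x F p a b ^ r * y F p a b ^ j) := by
          rw [pow_add, x_pow, add_mul, ← pow_succ', add_mul, Algebra.smul_def, mul_assoc _ _ (_ ^ j)]
        exact h3 ▸ M.add_mem h1 h2
  have hmem (i j : ℕ) : x F p a b ^ i * y F p a b ^ j ∈ M := by
    have h : x F p a b ^ i * y F p a b ^ j =
        b ^ (j / p) • (x F p a b ^ i * y F p a b ^ (j % p)) := by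
      conv_lhs => rw [← Nat.mod_add_div j p, pow_add, pow_mul, y_pow, ← map_pow, ← mul_assoc,
        ← Algebra.commutes, ← Algebra.smul_def]
    exact h ▸ M.smul_mem _ (hxy i (Nat.mod_lt _ hp.pos))
  have hsemi : SemiconjBy (y F p a b) (x F p a b) (x F p a b + 1) := y_mul_x
  have hleft (d : ASSymbol F p a b) : ∀ z ∈ M, d * z ∈ M := by
    have hd : d ∈ Algebra.adjoin F {x F p a b, y F p a b} := by
      rw [adjoin_eq_top]; exact Algebra.mem_top
    induction hd using Algebra.adjoin_induction with
    | algebraMap r =>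
      intro z hz
      rw [← Algebra.smul_def]
      exact M.smul_mem r hz
    | add d d' _ _ h h' =>
      intro z hz
      rw [add_mul]
      exact M.add_mem (h z hz) (h' z hz)
    | mul d d' _ _ h h' =>
      intro z hz
      rw [mul_assoc]
      exact h _ (h' z hz)
    | mem d hd =>
      intro z hz
      induction hz using Submodule.span_induction with
      | zero => simp
      | add z z' _ _ h h' => rw [mul_add]; exact M.add_mem h h'
      | smul r z _ h => rw [mul_smul_comm]; exact M.smul_mem r h
      | mem z hz =>
        obtain ⟨⟨i, j⟩, rfl⟩ := hz
        rcases hd with rfl | rfl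
        · rw [← mul_assoc, ← pow_succ']
          exact hmem _ _
        · rw [← mul_assoc, (hsemi.pow_right i).eq, mul_assoc, ← pow_succ',
            (Commute.one_right (x F p a b)).add_pow, Finset.sum_mul]
          refine M.sum_mem fun m _ => ?_
          rw [one_pow, mul_one, ← nsmul_eq_mul', smul_mul_assoc]
          exact M.nsmul_mem (hmem _ _) _
  refine eq_top_iff.mpr fun d _ => ?_
  simpa using hleft d 1 (by simpa using hmem 0 0)

end ASSymbol

theorem List.prod_ofFn_mul_of_commute {M : Type*} [Monoid M] {n : ℕ} (f g : Fin n → M)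
    (h : ∀ i j, i ≠ j → Commute (f i) (g j)) :
    (List.ofFn (f * g)).prod = (List.ofFn f).prod * (List.ofFn g).prod := by
  induction n with
  | zero => simp
  | succ n ih =>
    simp only [List.ofFn_succ, List.prod_cons, Pi.mul_apply]
    have hc : Commute (List.ofFn fun i : Fin n => f i.succ).prod (g 0) :=
      Commute.list_prod_left _ _ fun z hz => by
        obtain ⟨i, rfl⟩ := (List.mem_ofFn' _ _).mp hz
        exact h _ _ (Fin.succ_ne_zero i)
    have := ih (fun i => f i.succ) (fun i => g i.succ)
      fun i j hij => h _ _ (Fin.succ_injective _ |>.ne hij)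
    simp only [Pi.mul_def] at this
    rw [this]
    simp only [mul_assoc]
    rw [← mul_assoc (g 0), ← hc.eq, mul_assoc]

namespace PiTensorProduct

variable {F : Type*} [Field F] {n : ℕ} {A : Fin n → Type*} [∀ i, Ring (A i)] [∀ i, Algebra F (A i)]

/-- Algebra homomorphisms with pairwise commuting ranges induce one on the tensor product. -/
noncomputable def liftOfCommute {B : Type*} [Ring B] [Algebra F B] (f : ∀ i, A i →ₐ[F] B)
    (hf : ∀ i j, i ≠ j → ∀ a b, Commute (f i a) (f j b)) : (⨂[F] i, A i) →ₐ[F] B :=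
  liftAlgHom ((MultilinearMap.mkPiAlgebraFin F n B).compLinearMap fun i => (f i).toLinearMap)
    (by simp [List.ofFn_const]) fun a b => by
      have h := List.prod_ofFn_mul_of_commute (fun i => f i (a i)) (fun i => f i (b i))
        fun i j hij => hf i j hij _ _
      simpa [Pi.mul_def] using h

theorem liftOfCommute_tprod {B : Type*} [Ring B] [Algebra F B] (f : ∀ i, A i →ₐ[F] B)
    (hf : ∀ i j, i ≠ j → ∀ a b, Commute (f i a) (f j b)) (a : ∀ i, A i) :
    liftOfCommute f hf (tprod F a) = (List.ofFn fun i => f i (a i)).prod := by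
  simp [liftOfCommute, liftAlgHom]

theorem span_tprod_of_span_eq_top {κ : Fin n → Type*} [∀ i, Fintype (κ i)] {g : ∀ i, κ i → A i}
    (hg : ∀ i, Submodule.span F (Set.range (g i)) = ⊤) :
    Submodule.span F (Set.range fun r : ∀ i, κ i => tprod F fun i => g i (r i)) = ⊤ := by
  classical
  rw [eq_top_iff, ← span_tprod_eq_top, Submodule.span_le]
  rintro _ ⟨a, rfl⟩
  choose c hc using fun i => (Submodule.mem_span_range_iff_exists_fun F).mp
    ((hg i).symm ▸ Submodule.mem_top : a i ∈ Submodule.span F (Set.range (g i)))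
  rw [← funext hc, MultilinearMap.map_sum]
  refine Submodule.sum_mem _ fun r _ => ?_
  rw [MultilinearMap.map_smul_univ]
  exact Submodule.smul_mem _ _ (Submodule.subset_span ⟨r, rfl⟩)

end PiTensorProduct

section Action

variable {F L : Type} [Field F] [Field L] [Algebra F L] {p n : ℕ}

theorem AlgHom.toEnd_mul_lmul (s : L →ₐ[F] L) (z : L) :
    AlgHom.toEnd s * Algebra.lmul F L z = Algebra.lmul F L (s z) * AlgHom.toEnd s := by
  ext w
  simp

theorem AlgHom.commute_lmul_toEnd {s : L →ₐ[F] L} {z : L} (h : s z = z) :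
    Commute (Algebra.lmul F L z) (AlgHom.toEnd s) := by
  have := AlgHom.toEnd_mul_lmul s z
  rw [h] at this
  exact this.symm

/-- The symbol algebra `[a,b)` acts on an extension `L` containing a root `u` of `X ^ p - X - a`
and a `p`-th root `t` of `b`, given an automorphism `s` of order `p` with `s u = u + 1` and
`s t = t`. -/
noncomputable def ASSymbol.toEnd {a b : F} (u t : L) (s : L →ₐ[F] L)
    (hu : u ^ p - u = algebraMap F L a) (ht : t ^ p = algebraMap F L b) (hsu : s u = u + 1)
    (hst : s t = t) (hs : s ^ p = 1) : ASSymbol F p a b →ₐ[F] Module.End F L :=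
  ASSymbol.lift (Algebra.lmul F L u) (Algebra.lmul F L t * AlgHom.toEnd s)
    (by rw [← map_pow, ← map_sub, hu, AlgHom.commutes])
    (by
      have h := AlgHom.commute_lmul_toEnd hst
      rw [h.mul_pow, ← map_pow, ← map_pow, hs, map_one, mul_one, ht, AlgHom.commutes])
    (by
      rw [mul_assoc, AlgHom.toEnd_mul_lmul, hsu, map_add, map_one, ← mul_assoc, ← mul_assoc]
      congr 1
      rw [← map_one (Algebra.lmul F L), ← map_add, ← map_mul, ← map_mul, mul_comm])

theorem ASSymbol.toEnd_monomial {a b : F} {u t : L} {s : L →ₐ[F] L}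
    (hu : u ^ p - u = algebraMap F L a) (ht : t ^ p = algebraMap F L b) (hsu : s u = u + 1)
    (hst : s t = t) (hs : s ^ p = 1) (i j : ℕ) :
    ASSymbol.toEnd u t s hu ht hsu hst hs (x F p a b ^ i * y F p a b ^ j) =
      Algebra.lmul F L (u ^ i * t ^ j) * AlgHom.toEnd (s ^ j) := by
  have h := AlgHom.commute_lmul_toEnd hst
  rw [map_mul, map_pow, map_pow, toEnd, lift_x, lift_y, h.mul_pow, ← map_pow, ← map_pow, ← map_pow,
    ← mul_assoc, ← map_mul]

variable {α β : Fin n → F} {x t : Fin n → L} {s : Fin n → L →ₐ[F] L}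

/-- The diagonal action of a tensor product of symbol algebras on `L`. -/
theorem PiTensorProduct.exists_algHom_end_tprod_monomial
    (hx : ∀ i, x i ^ p - x i = algebraMap F L (β i)) (ht : ∀ i, t i ^ p = algebraMap F L (α i))
    (hsx : ∀ i j, s i (x j) = x j + if j = i then 1 else 0) (hst : ∀ i j, s i (t j) = t j)
    (hss : ∀ i j, (s i).comp (s j) = (s j).comp (s i)) (hsp : ∀ i, s i ^ p = 1) :
    ∃ ρ : (⨂[F] i, ASSymbol F p (β i) (α i)) →ₐ[F] Module.End F L, ∀ a b : Fin n → ℕ, ∀ w : L,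
      ρ (PiTensorProduct.tprod F fun i =>
        ASSymbol.x F p (β i) (α i) ^ a i * ASSymbol.y F p (β i) (α i) ^ b i) w =
      (∏ i, x i ^ a i) * ((∏ i, t i ^ b i) * (List.ofFn fun i => s i ^ b i).prod w) := by
  have hsx' (i j : Fin n) (hij : i ≠ j) : s i (x j) = x j := by simp [hsx, hij.symm]
  let φ (i : Fin n) : ASSymbol F p (β i) (α i) →ₐ[F] Module.End F L :=
    ASSymbol.toEnd (x i) (t i) (s i) (hx i) (ht i) (by simp [hsx]) (hst i i) (hsp i)
  have hφx (i : Fin n) : φ i (ASSymbol.x F p (β i) (α i)) = Algebra.lmul F L (x i) :=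
    ASSymbol.lift_x ..
  have hφy (i : Fin n) : φ i (ASSymbol.y F p (β i) (α i)) =
      Algebra.lmul F L (t i) * AlgHom.toEnd (s i) := ASSymbol.lift_y ..
  have hcomm (i j : Fin n) (hij : i ≠ j) (d : ASSymbol F p (β i) (α i))
      (d' : ASSymbol F p (β j) (α j)) : Commute (φ i d) (φ j d') := by
    refine ASSymbol.commute_of_commute_generators _ ?_ ?_ d <;>
      refine (ASSymbol.commute_of_commute_generators _ ?_ ?_ d').symm <;>
      simp only [hφx, hφy] <;> ext w <;>
      simp [hst, hsx' _ _ hij, hsx' _ _ hij.symm, mul_left_comm]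
    exact Or.inl (Or.inl (DFunLike.congr_fun (hss j i) w))
  refine ⟨liftOfCommute φ hcomm, fun a b w => ?_⟩
  rw [liftOfCommute_tprod]
  have h := List.prod_ofFn_mul_of_commute (fun i => Algebra.lmul F L (x i ^ a i * t i ^ b i))
    (fun i => AlgHom.toEnd (s i ^ b i)) fun i j hij => by
      have hfix : (s j ^ b j) (x i ^ a i * t i ^ b i) = x i ^ a i * t i ^ b i := by
        generalize b j = m
        induction m with
        | zero => simp
        | succ m ih =>
          rw [pow_succ', AlgHom.mul_apply, ih]
          simp [hst, hsx' _ _ hij.symm]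
      exact AlgHom.commute_lmul_toEnd hfix
  have hmap {M N : Type} [Monoid M] [Monoid N] (g : M →* N) (z : Fin n → M) :
      (List.ofFn fun i => g (z i)).prod = g (List.ofFn z).prod := by
    rw [map_list_prod, List.map_ofFn]; rfl
  have h1 := hmap (Algebra.lmul F L : L →* Module.End F L) fun i => x i ^ a i * t i ^ b i
  have h2 := hmap (AlgHom.toEnd : (L →ₐ[F] L) →* Module.End F L) fun i => s i ^ b i
  have h3 : (List.ofFn fun i => φ i (ASSymbol.x F p (β i) (α i) ^ a i *
      ASSymbol.y F p (β i) (α i) ^ b i)).prod =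
      Algebra.lmul F L (∏ i, x i ^ a i * t i ^ b i) *
        AlgHom.toEnd (List.ofFn fun i => s i ^ b i).prod := by
    rw [← h2, ← List.prod_ofFn]
    refine Eq.trans ?_ (h.trans (congrArg (· * _) h1))
    congr 2
    funext i
    exact ASSymbol.toEnd_monomial ..
  rw [h3]
  simp [Finset.prod_mul_distrib, mul_assoc]

theorem apply_prod_ofFn_pow_eq {T : Type*} {v : L → T} (hvs : ∀ i z, v (s i z) = v z)
    (b : Fin n → ℕ) (w : L) : v ((List.ofFn fun i => s i ^ b i).prod w) = v w := by
  have hpow (i : Fin n) (m : ℕ) (w : L) : v ((s i ^ m) w) = v w := by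
    induction m with
    | zero => simp
    | succ m ih => rw [pow_succ', AlgHom.mul_apply, hvs, ih]
  have h : ∀ q ∈ List.ofFn (fun i => s i ^ b i), ∀ w, v (q w) = v w := by
    intro q hq
    obtain ⟨i, rfl⟩ := (List.mem_ofFn' _ _).mp hq
    exact hpow i (b i)
  generalize List.ofFn (fun i => s i ^ b i) = l at h
  induction l with
  | nil => simp
  | cons q l ih =>
    rw [List.prod_cons, AlgHom.mul_apply, h q List.mem_cons_self,
      ih fun q hq => h q (List.mem_cons_of_mem _ hq)]

/-- A combination of the operators `x ^ a t ^ b s ^ b` with coefficients in `F`, not all zero, is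
injective on `L`, provided that `L` has a valuation `v` for which the monomials in the `t i`
represent the classes modulo `p` and the combinations of the monomials in the `x i` have valuation
divisible by `p`. -/
theorem sum_monomial_operators_ne_zero {v : L → Fin n → ℤ}
    (hv : ∀ {z w}, z ≠ 0 → w ≠ 0 → v (z * w) = v z + v w)
    (ht0 : ∀ i, t i ≠ 0) (hvt : ∀ b : Fin n → ℕ, v (∏ i, t i ^ b i) = fun i => (b i : ℤ))
    (hvs : ∀ i z, v (s i z) = v z)
    (hsum : ∀ {S : Finset (Fin n → Fin p)}, S.Nonempty → ∀ {f : (Fin n → Fin p) → L},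
      (∀ b ∈ S, f b ≠ 0) → Set.InjOn (fun b => v (f b)) S → ∑ b ∈ S, f b ≠ 0)
    (hcomb : ∀ {c : (Fin n → Fin p) → F}, c ≠ 0 →
      (∑ a, algebraMap F L (c a) * ∏ i, x i ^ (a i : ℕ)) ≠ 0 ∧
        ∀ i, (p : ℤ) ∣ v (∑ a, algebraMap F L (c a) * ∏ i, x i ^ (a i : ℕ)) i)
    {c : (Fin n → Fin p × Fin p) → F} (hc : c ≠ 0) {w : L} (hw : w ≠ 0) :
    ∑ r, c r • ((∏ i, x i ^ ((r i).1 : ℕ)) * ((∏ i, t i ^ ((r i).2 : ℕ)) *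
      (List.ofFn fun i => s i ^ ((r i).2 : ℕ)).prod w)) ≠ 0 := by
  let c' (b a : Fin n → Fin p) : F := c fun i => (a i, b i)
  let X (b : Fin n → Fin p) : L := ∑ a, algebraMap F L (c' b a) * ∏ i, x i ^ (a i : ℕ)
  let Y (b : Fin n → Fin p) : L :=
    (∏ i, t i ^ (b i : ℕ)) * (List.ofFn fun i => s i ^ (b i : ℕ)).prod w
  have hY0 (b) : Y b ≠ 0 := mul_ne_zero
    (Finset.prod_ne_zero_iff.mpr fun i _ => pow_ne_zero _ (ht0 i))
    ((map_ne_zero_iff _ (RingHom.injective (List.ofFn fun i => s i ^ (b i : ℕ)).prod.toRingHom)).mpr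
      hw)
  have hX0 {b} (hb : c' b ≠ 0) : X b ≠ 0 := (hcomb hb).1
  have hvY (b) : v (Y b) = (fun i => ((b i : ℕ) : ℤ)) + v w := by
    rw [hv (left_ne_zero_of_mul (hY0 b)) (right_ne_zero_of_mul (hY0 b)), hvt,
      apply_prod_ofFn_pow_eq hvs]
  classical
  have hS : ∑ b, X b * Y b = ∑ b with c' b ≠ 0, X b * Y b := by
    rw [Finset.sum_filter_of_ne]
    rintro b - h hb
    exact h (by simp [X, hb])
  rw [← (Equiv.arrowProdEquivProdArrow (Fin n) (fun _ => Fin p) fun _ => Fin p).symm.sum_comp,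
    Fintype.sum_prod_type_right]
  have hXY : ∑ b, X b * Y b = ∑ b : Fin n → Fin p, ∑ a : Fin n → Fin p, c' b a •
      ((∏ i, x i ^ (a i : ℕ)) * Y b) := by
    refine Finset.sum_congr rfl fun b _ => ?_
    rw [Finset.sum_mul]
    refine Finset.sum_congr rfl fun a _ => ?_
    rw [Algebra.smul_def, mul_assoc]
  refine ne_of_eq_of_ne (hXY.symm.trans hS) ?_
  refine hsum ?_ (fun b hb => mul_ne_zero (hX0 (Finset.mem_filter.mp hb).2) (hY0 b)) ?_
  · by_contra hemp
    refine hc (funext fun r => ?_)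
    have h := Finset.filter_eq_empty_iff.mp (Finset.not_nonempty_iff_eq_empty.mp hemp)
      (Finset.mem_univ fun i => (r i).2)
    exact congrFun (not_not.mp h) fun i => (r i).1
  · intro b hb b' hb' h
    have hb := (Finset.mem_filter.mp hb).2
    have hb' := (Finset.mem_filter.mp hb').2
    simp only [hv (hX0 hb) (hY0 b), hv (hX0 hb') (hY0 b'), hvY] at h
    funext i
    have hi := congrFun h i
    simp only [Pi.add_apply] at hi
    obtain ⟨e, he⟩ : (p : ℤ) ∣ v (X b) i := (hcomb hb).2 i
    obtain ⟨e', he'⟩ : (p : ℤ) ∣ v (X b') i := (hcomb hb').2 i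
    have hmod : ((b i : ℕ) : ℤ) ≡ ((b' i : ℕ) : ℤ) [ZMOD p] :=
      Int.modEq_iff_dvd.mpr ⟨e - e', by linear_combination -hi + he - he'⟩
    exact Fin.ext ((Int.natCast_modEq_iff.mp hmod).eq_of_lt_of_lt (b i).2 (b' i).2)

/-- A finite-dimensional algebra acting on a nonzero space such that nonzero elements act
injectively is a division algebra. -/
theorem isDivisionAlgebra_of_injective_action {D : Type} [Ring D] [Algebra F D]
    [FiniteDimensional F D] (ρ : D →ₐ[F] Module.End F L)
    (hρ : ∀ d, d ≠ 0 → ∀ w, w ≠ 0 → ρ d w ≠ 0) : IsDivisionAlgebra D := by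
  have hnt : Nontrivial D :=
    ⟨⟨1, 0, fun h => one_ne_zero (α := Module.End F L) (by rw [← map_one ρ, h, map_zero])⟩⟩
  have : NoZeroDivisors D := by
    refine ⟨fun {d d'} h => or_iff_not_imp_left.mpr fun hd => by_contra fun hd' => ?_⟩
    refine hρ d hd _ (hρ d' hd' 1 one_ne_zero) ?_
    rw [← Module.End.mul_apply, ← map_mul, h, map_zero, LinearMap.zero_apply]
  have : IsDomain D := NoZeroDivisors.to_isDomain _
  exact ⟨hnt, fun d hd => FiniteDimensional.isUnit F hd⟩

theorem isDivisionAlgebra_piTensorProduct_of_action [Fact p.Prime]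
    (hx : ∀ i, x i ^ p - x i = algebraMap F L (β i)) (ht : ∀ i, t i ^ p = algebraMap F L (α i))
    (hsx : ∀ i j, s i (x j) = x j + if j = i then 1 else 0) (hst : ∀ i j, s i (t j) = t j)
    (hss : ∀ i j, (s i).comp (s j) = (s j).comp (s i)) (hsp : ∀ i, s i ^ p = 1)
    {v : L → Fin n → ℤ} (hv : ∀ {z w}, z ≠ 0 → w ≠ 0 → v (z * w) = v z + v w)
    (ht0 : ∀ i, t i ≠ 0) (hvt : ∀ b : Fin n → ℕ, v (∏ i, t i ^ b i) = fun i => (b i : ℤ))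
    (hvs : ∀ i z, v (s i z) = v z)
    (hsum : ∀ {S : Finset (Fin n → Fin p)}, S.Nonempty → ∀ {f : (Fin n → Fin p) → L},
      (∀ b ∈ S, f b ≠ 0) → Set.InjOn (fun b => v (f b)) S → ∑ b ∈ S, f b ≠ 0)
    (hcomb : ∀ {c : (Fin n → Fin p) → F}, c ≠ 0 →
      (∑ a, algebraMap F L (c a) * ∏ i, x i ^ (a i : ℕ)) ≠ 0 ∧
        ∀ i, (p : ℤ) ∣ v (∑ a, algebraMap F L (c a) * ∏ i, x i ^ (a i : ℕ)) i) :
    IsDivisionAlgebra (⨂[F] i, ASSymbol F p (β i) (α i)) := by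
  obtain ⟨ρ, hρ⟩ := PiTensorProduct.exists_algHom_end_tprod_monomial hx ht hsx hst hss hsp
  have hspan := PiTensorProduct.span_tprod_of_span_eq_top (κ := fun _ => Fin p × Fin p)
    (g := fun i (r : Fin p × Fin p) => ASSymbol.x F p (β i) (α i) ^ (r.1 : ℕ) *
      ASSymbol.y F p (β i) (α i) ^ (r.2 : ℕ)) fun i => ASSymbol.span_monomials
  have : FiniteDimensional F (⨂[F] i, ASSymbol F p (β i) (α i)) :=
    Module.finite_def.mpr (hspan ▸ Submodule.fg_span (Set.finite_range _))
  refine isDivisionAlgebra_of_injective_action ρ fun d hd w hw => ?_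
  have hmem : d ∈ (⊤ : Submodule F (⨂[F] i, ASSymbol F p (β i) (α i))) := Submodule.mem_top
  rw [← hspan] at hmem
  obtain ⟨c, rfl⟩ := (Submodule.mem_span_range_iff_exists_fun F).mp hmem
  have hc : c ≠ 0 := fun h => hd (by simp [h])
  refine ne_of_eq_of_ne ?_ (sum_monomial_operators_ne_zero hv ht0 hvt hvs hsum hcomb hc hw)
  rw [map_sum, LinearMap.sum_apply]
  refine Finset.sum_congr rfl fun r _ => ?_
  rw [map_smul, LinearMap.smul_apply]
  exact congrArg _ (hρ (fun i => ((r i).1 : ℕ)) (fun i => ((r i).2 : ℕ)) w)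

end Action

/-- Let `p` be prime, `k` a field of characteristic `p`, `n ≥ 1`, and
`F = k((α₁))…((αₙ))`. If `β₁, …, βₙ ∈ k` have `𝔽ₚ`-linearly independent images in
`k/℘(k)`, then `D = [β₁,α₁)_{p,F} ⊗ ⋯ ⊗ [βₙ,αₙ)_{p,F}` is a division algebra over `F`. -/
theorem iterLaurent_tensor_symbols_isDivision_of_indep (p : ℕ) (hp : p.Prime) (k : Type)
    [Field k] [CharP k p] (n : ℕ) (hn : 1 ≤ n) (β : Fin n → k)
    (hβ : IndepModArtinSchreier k p β) :
    IsDivisionAlgebra (⨂[IterLaurent k n] (i : Fin n),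
      ASSymbol (IterLaurent k n) p
        (IterLaurent.ofBase k n (β i)) (IterLaurent.var k n i)) := by
  have : Fact p.Prime := ⟨hp⟩
  have : NeZero p := ⟨hp.ne_zero⟩
  obtain ⟨l, _, _, x, s, hx, hsx, hss, hsp, hli⟩ := exists_artinSchreier_extension hβ
  let : Algebra (IterLaurent k n) (IterLaurent l n) :=
    (IterLaurent.mapExpand (algebraMap k l) p n).toAlgebra
  let σ (q : l →ₐ[k] l) : IterLaurent l n →ₐ[IterLaurent k n] IterLaurent l n :=
    { IterLaurent.mapExpand (q : l →+* l) 1 n with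
      commutes' := fun z => (IterLaurent.mapExpand_one_mapExpand (q : l →+* l) (algebraMap k l) p n
        z).trans (by rw [q.comp_algebraMap]; rfl) }
  have hσ (q : l →ₐ[k] l) (z : IterLaurent l n) :
      σ q z = IterLaurent.mapExpand (q : l →+* l) 1 n z := rfl
  have hσ_mul (q q' : l →ₐ[k] l) : σ (q * q') = σ q * σ q' :=
    AlgHom.ext fun z => (IterLaurent.mapExpand_one_mapExpand (q : l →+* l) (q' : l →+* l) 1 n z).symm
  have hσ_one : σ 1 = 1 :=
    AlgHom.ext fun z => DFunLike.congr_fun (IterLaurent.mapExpand_id_one n) z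
  have hσ_pow (q : l →ₐ[k] l) (m : ℕ) : σ (q ^ m) = σ q ^ m :=
    map_pow (⟨⟨σ, hσ_one⟩, hσ_mul⟩ : (l →ₐ[k] l) →* _) q m
  refine isDivisionAlgebra_piTensorProduct_of_action
    (x := fun i => IterLaurent.ofBase l n (x i)) (t := IterLaurent.var l n) (s := fun i => σ (s i))
    (v := IterLaurent.exponent n)
    (fun i => ?_) (fun i => (IterLaurent.mapExpand_var _ p n i).symm) (fun i j => ?_)
    (fun i j => ?_) (fun i j => ?_) (fun i => ?_) (IterLaurent.exponent_mul n)
    (IterLaurent.var_ne_zero n) (IterLaurent.exponent_prod_var_pow n)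
    (fun i => IterLaurent.exponent_mapExpand_one _ n)
    (fun hS => IterLaurent.sum_ne_zero_of_exponent_injOn n hS) (fun {c} hc => ?_)
  · rw [← map_pow, ← map_sub, hx]
    exact (IterLaurent.mapExpand_ofBase _ p n _).symm
  · rw [hσ, IterLaurent.mapExpand_ofBase]
    refine (congrArg (IterLaurent.ofBase l n) (hsx i j)).trans ?_
    split_ifs <;> simp
  · rw [hσ, IterLaurent.mapExpand_var, pow_one]
  · exact (hσ_mul _ _).symm.trans ((congrArg σ (hss i j)).trans (hσ_mul _ _))
  · rw [← hσ_pow, hsp, hσ_one]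
  · have h := IterLaurent.sum_mapExpand_mul_ofBase p n hli hc
    simp only [map_prod, map_pow] at h
    exact h
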